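/- Let d ≥ 1, a, b > 0, and let h : ℝ → ℝ be continuously differentiable with inf_{x ∈ ℝ} |h'(x)| = a > 0, and such that for all x ∈ ℝ and all y ≠ 0: |d/dx (1/(h(x+y) − h(x)))| ≤ b (1 + 1/|y|). Let ω ∈ ℝ^d satisfy ω·k ≠ 0 and 1/|ω·k| ≤ C |k|^γ for all k ∈ ℤ^d, k ≠ 0, for some C > 0 and γ > 0. Define λ_n := h(ω·n) for n ∈ ℤ^d. Then the values λ_n are pairwise distinct and there exists c ≥ 1 such that (λ_n)_{n ∈ ℤ^d} satisfies conditions (A1)–(A3) with constant c and exponent γ. -/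

import Mathlib

noncomputable section

abbrev Zd (d : ℕ) := Fin d → ℤ

/-- `|k| = |k₁| + ⋯ + |k_d|` as a real number. -/
def absZ {d : ℕ} (k : Zd d) : ℝ := ∑ i, |(k i : ℝ)|

theorem aux_lower (a : ℝ) (h : ℝ → ℝ) (hd : Differentiable ℝ h)
    (hl : ∀ x, a ≤ |deriv h x|) (x y : ℝ) : a * |y| ≤ |h (x + y) - h x| := by
  have key : ∀ u v : ℝ, u < v → a * (v - u) ≤ |h v - h u| := by
    intro u v huv
    obtain ⟨c, _, hc⟩ := exists_deriv_eq_slope h huv hd.continuous.continuousOn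
      hd.differentiableOn
    have h1 : h v - h u = deriv h c * (v - u) := by
      rw [hc]; field_simp [(sub_pos.2 huv).ne']
    rw [h1, abs_mul, abs_of_pos (sub_pos.2 huv)]
    exact mul_le_mul_of_nonneg_right (hl c) (sub_pos.2 huv).le
  rcases lt_trichotomy y 0 with hy | hy | hy
  · have := key (x + y) x (by linarith)
    rw [abs_of_neg hy, abs_sub_comm]
    linarith
  · simp [hy]
  · have := key x (x + y) (by linarith)
    rw [abs_of_pos hy]
    linarith

theorem aux_upper (h : ℝ → ℝ) (hh : ContDiff ℝ 1 h) :
    ∃ M : ℝ, 0 ≤ M ∧ ∀ y : ℝ, |y| ≤ 1 → |h y - h 0| ≤ M * |y| := by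
  have hc : Continuous (deriv h) := hh.continuous_deriv le_rfl
  obtain ⟨M, hM⟩ := (isCompact_Icc (a := (-1 : ℝ)) (b := 1)).exists_bound_of_continuousOn
    hc.continuousOn
  refine ⟨M, (norm_nonneg _).trans (hM 0 (by norm_num)), fun y hy => ?_⟩
  have := (convex_Icc (-1 : ℝ) 1).norm_image_sub_le_of_norm_deriv_le
    (f := h) (C := M) (x := 0) (y := y)
    (fun x _ => (hh.differentiable one_ne_zero) x) hM (by norm_num) (abs_le.1 hy)
  simpa [Real.norm_eq_abs] using this

theorem aux_lip (a b : ℝ) (ha : 0 < a) (h : ℝ → ℝ) (hd : Differentiable ℝ h)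
    (hl : ∀ x, a ≤ |deriv h x|)
    (hder : ∀ x y : ℝ, y ≠ 0 →
      |deriv (fun t => (h (t + y) - h t)⁻¹) x| ≤ b * (1 + 1 / |y|)) (x z y : ℝ) (hy : y ≠ 0) :
    |1 / (h (x + z + y) - h (x + z)) - 1 / (h (x + y) - h x)| ≤ b * (1 + 1 / |y|) * |z| := by
  have hdf : ∀ t, DifferentiableAt ℝ (fun t => (h (t + y) - h t)⁻¹) t := by
    intro t
    have h0 : h (t + y) - h t ≠ 0 := by
      have := aux_lower a h hd hl t y
      have h2 := mul_pos ha (abs_pos.2 hy)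
      exact abs_pos.1 (h2.trans_le this)
    have h1 : DifferentiableAt ℝ (fun t => h (t + y) - h t) t := by fun_prop
    exact h1.inv h0
  have := convex_univ.norm_image_sub_le_of_norm_deriv_le
    (f := fun t => (h (t + y) - h t)⁻¹) (C := b * (1 + 1 / |y|)) (x := x) (y := x + z)
    (fun t _ => hdf t) (fun t _ => hder t y hy) (Set.mem_univ _) (Set.mem_univ _)
  simpa [Real.norm_eq_abs] using this

theorem composed_sequence_satisfies_A1_A2_A3
    (d : ℕ) (hd : 1 ≤ d) (a b : ℝ) (ha : 0 < a) (hb : 0 < b)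
    (h : ℝ → ℝ) (hh : ContDiff ℝ 1 h)
    (hglb : IsGLB (Set.range fun x => |deriv h x|) a)
    (hder : ∀ x y : ℝ, y ≠ 0 →
      |deriv (fun t => (h (t + y) - h t)⁻¹) x| ≤ b * (1 + 1 / |y|))
    (ω : Fin d → ℝ) (C γ : ℝ) (hC : 0 < C) (hγ : 0 < γ)
    (hω : ∀ k : Zd d, k ≠ 0 → (∑ i, ω i * k i) ≠ 0)
    (hdiof : ∀ k : Zd d, k ≠ 0 → 1 / |∑ i, ω i * k i| ≤ C * absZ k ^ γ) :
    let lam : Zd d → ℝ := fun n => h (∑ i, ω i * n i)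
    (∀ n m : Zd d, n ≠ m → lam n ≠ lam m) ∧
    ∃ c : ℝ, 1 ≤ c ∧
      (∀ (n k : Zd d), k ≠ 0 → 1 / |lam (n + k) - lam n| ≤ c * absZ k ^ γ) ∧
      (∀ (n k : Zd d), k ≠ 0 →
        1 / |lam (n + k) - lam n| ≤ c * (1 + 1 / |lam k - lam 0|)) ∧
      (∀ (n j k : Zd d), j ≠ 0 → k ≠ 0 →
        |(1 / (lam j - lam 0)) *
          (1 / (lam (n + j + k) - lam (n + j)) - 1 / (lam (n + k) - lam n))| ≤
          c * (1 + 1 / |lam k - lam 0|)) := by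
  intro lam
  have hdf : Differentiable ℝ h := hh.differentiable one_ne_zero
  have hl : ∀ x, a ≤ |deriv h x| := fun x => hglb.1 ⟨x, rfl⟩
  have hlow := aux_lower a h hdf hl
  obtain ⟨M, hM0, hM⟩ := aux_upper h hh
  have hadd : ∀ n k : Zd d, (∑ i, ω i * ((n + k) i : ℤ)) =
      (∑ i, ω i * n i) + ∑ i, ω i * k i := by
    intro n k
    rw [← Finset.sum_add_distrib]
    refine Finset.sum_congr rfl fun i _ => ?_
    rw [Pi.add_apply]; push_cast; ring
  have hzero : (∑ i, ω i * ((0 : Zd d) i : ℤ)) = 0 := by simp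
  have hlamadd : ∀ n k : Zd d, lam (n + k) = h ((∑ i, ω i * n i) + ∑ i, ω i * k i) := by
    intro n k
    simp only [lam, hadd]
  have hlam0 : lam 0 = h 0 := by simp only [lam, hzero]
  -- bound for the reciprocal difference
  have hrec : ∀ x y : ℝ, y ≠ 0 → 1 / |h (x + y) - h x| ≤ 1 / a * (1 / |y|) := by
    intro x y hy
    rw [one_div_mul_one_div]
    exact one_div_le_one_div_of_le (mul_pos ha (abs_pos.2 hy)) (hlow x y)
  have hkey : ∀ y : ℝ, y ≠ 0 → 1 + 1 / |y| ≤ (2 + M) * (1 + 1 / |h y - h 0|) := by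
    intro y hy
    have hy' := abs_pos.2 hy
    have hp : 0 < |h y - h 0| := by
      have := hlow 0 y
      rw [zero_add] at this
      exact (mul_pos ha hy').trans_le this
    have hD : 0 ≤ 1 / |h y - h 0| := by positivity
    have : 1 / |y| ≤ 1 + M * (1 / |h y - h 0|) := by
      rcases le_total |y| 1 with h1 | h1
      · have h2 : 1 / |y| ≤ M * (1 / |h y - h 0|) := by
          rw [mul_one_div, div_le_div_iff₀ hy' hp]
          linarith [hM y h1]
        linarith
      · have h2 : 1 / |y| ≤ 1 := by
          rw [div_le_one hy']; exact h1
        have := mul_nonneg hM0 hD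
        linarith
    nlinarith
  refine ⟨?_, 1 + C / a + (2 + M) / a + b * (2 + M) / a, ?_, ?_, ?_, ?_⟩
  · intro n m hnm heq
    have hk : n - m ≠ 0 := sub_ne_zero.2 hnm
    have h1 := hlow (∑ i, ω i * m i) (∑ i, ω i * ((n - m) i : ℤ))
    rw [← hlamadd, add_sub_cancel, heq] at h1
    have h2 := mul_pos ha (abs_pos.2 (hω _ hk))
    simp [lam] at h1 h2
    linarith
  · have : 0 ≤ C / a + (2 + M) / a + b * (2 + M) / a := by positivity
    linarith
  · intro n k hk
    rw [hlamadd]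
    refine (hrec _ _ (hω k hk)).trans ?_
    have hnn : 0 ≤ absZ k ^ γ :=
      Real.rpow_nonneg (Finset.sum_nonneg fun i _ => abs_nonneg _) _
    calc _ ≤ 1 / a * (C * absZ k ^ γ) :=
          mul_le_mul_of_nonneg_left (hdiof k hk) (by positivity)
      _ = (C / a) * absZ k ^ γ := by ring
      _ ≤ _ := by
          refine mul_le_mul_of_nonneg_right ?_ hnn
          have : 0 ≤ (2 + M) / a + b * (2 + M) / a := by positivity
          linarith
  · intro n k hk
    rw [hlamadd, hlam0]
    refine (hrec _ _ (hω k hk)).trans ?_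
    have hD : 0 ≤ 1 + 1 / |lam k - h 0| := by positivity
    calc _ ≤ 1 / a * ((2 + M) * (1 + 1 / |lam k - h 0|)) := by
          refine mul_le_mul_of_nonneg_left ?_ (by positivity)
          have := hkey _ (hω k hk)
          simp only [lam]
          linarith
      _ = ((2 + M) / a) * (1 + 1 / |lam k - h 0|) := by ring
      _ ≤ _ := by
          refine mul_le_mul_of_nonneg_right ?_ hD
          have : 0 ≤ C / a + b * (2 + M) / a := by positivity
          linarith
  · intro n j k hj hk
    have hD : 0 ≤ 1 + 1 / |lam k - h 0| := by positivity
    have h1 := aux_lip a b ha h hdf hl hder (∑ i, ω i * n i) (∑ i, ω i * j i) _ (hω k hk)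
    have h2 := hrec 0 _ (hω j hj)
    have h3 := hkey _ (hω k hk)
    have hz := abs_pos.2 (hω j hj)
    rw [hlamadd (n + j), hlamadd n j, hlamadd n k, hadd, hlam0, abs_mul, abs_div, abs_one]
    rw [zero_add] at h2
    calc _ ≤ (1 / a * (1 / |∑ i, ω i * j i|)) *
          (b * (1 + 1 / |∑ i, ω i * k i|) * |∑ i, ω i * j i|) :=
          mul_le_mul h2 h1 (abs_nonneg _) (by positivity)
      _ = b / a * (1 + 1 / |∑ i, ω i * k i|) := by
          generalize |∑ i, ω i * (j i : ℝ)| = z at hz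
          generalize (1 + 1 / |∑ i, ω i * (k i : ℝ)|) = w
          field_simp
      _ ≤ b / a * ((2 + M) * (1 + 1 / |lam k - h 0|)) :=
          mul_le_mul_of_nonneg_left h3 (by positivity)
      _ = (b * (2 + M) / a) * (1 + 1 / |lam k - h 0|) := by ring
      _ ≤ _ := by
          refine mul_le_mul_of_nonneg_right ?_ hD
          have : 0 ≤ C / a + (2 + M) / a := by positivity
          linarith
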